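/- Let A be a real d-dimensional tensor of size n₁ × ⋯ × n_d, and for k = 1,…,d−1 let A_k denote its k-th unfolding, the matrix of size (n₁⋯n_k) × (n_{k+1}⋯n_d) with A_k((i₁,…,i_k),(i_{k+1},…,i_d)) = A(i₁,…,i_d). Given target ranks r₁,…,r_{d-1}, let ε_k = min over matrices M of rank at most r_k of ‖A_k − M‖_F (the Frobenius distance from A_k to its best rank-r_k approximation). Then there exists a tensor B of size n₁ × ⋯ × n_d in tensor-train format with TT-ranks at most r₁,…,r_{d-1} such that ‖A − B‖_F² ≤ Σ_{k=1}^{d-1} ε_k². -/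

import Mathlib

open scoped BigOperators

/-- A real `d`-dimensional tensor of size `n 0 × n 1 × ⋯ × n (d-1)`:
a function from `(Fin (n 0)) × ⋯ × (Fin (n (d-1)))` to `ℝ`. -/
def Tensor {d : ℕ} (n : Fin d → ℕ) : Type :=
  ((k : Fin d) → Fin (n k)) → ℝ

/-- The type of tensor-train cores for a tensor of size `n 0 × ⋯ × n (d-1)` with
TT-ranks `r 0, r 1, …, r d` (so `G k i` is an `r k × r (k+1)` matrix for each
`i : Fin (n k)`; a genuine TT representation moreover has `r 0 = r d = 1`). -/
def TTCores {d : ℕ} (r : Fin (d + 1) → ℕ) (n : Fin d → ℕ) : Type :=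
  (k : Fin d) → Fin (n k) →
    Matrix (Fin (r ⟨(k : ℕ), Nat.lt_succ_of_lt k.isLt⟩))
      (Fin (r ⟨(k : ℕ) + 1, Nat.succ_lt_succ k.isLt⟩)) ℝ

/-- Partial products `G₁(i₁) G₂(i₂) ⋯ G_j(i_j)` of tensor-train cores. -/
def ttPartial {d : ℕ} (r : Fin (d + 1) → ℕ) (n : Fin d → ℕ)
    (G : TTCores r n) (i : (k : Fin d) → Fin (n k)) :
    (j : ℕ) → (hj : j ≤ d) →
      Matrix (Fin (r ⟨0, Nat.succ_pos d⟩)) (Fin (r ⟨j, Nat.lt_succ_of_le hj⟩)) ℝ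
  | 0, _ => 1
  | j + 1, hj => ttPartial r n G i j (Nat.le_of_succ_le hj) * G ⟨j, hj⟩ (i ⟨j, hj⟩)

/-- The value of the tensor in tensor-train format with cores `G`:
`X(i₁,…,i_d) = G₁(i₁) G₂(i₂) ⋯ G_d(i_d)`, a product of matrices yielding a `1 × 1`
matrix (since `r 0 = r d = 1`), identified with a real number. -/
def ttEval {d : ℕ} (r : Fin (d + 1) → ℕ) (n : Fin d → ℕ) (G : TTCores r n)
    (h0 : r ⟨0, Nat.succ_pos d⟩ = 1) (hlast : r ⟨d, Nat.lt_succ_self d⟩ = 1)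
    (i : (k : Fin d) → Fin (n k)) : ℝ :=
  ttPartial r n G i d le_rfl (Fin.cast h0.symm 0) (Fin.cast hlast.symm 0)

/-- The Frobenius norm of a tensor: the square root of the sum of the squares of all
its entries. -/
noncomputable def frobT {d : ℕ} {n : Fin d → ℕ} (X : Tensor n) : ℝ :=
  Real.sqrt (∑ i : (k : Fin d) → Fin (n k), X i ^ 2)

/-- The Frobenius norm of a matrix. -/
noncomputable def frobM {α β : Type*} [Fintype α] [Fintype β] (M : Matrix α β ℝ) : ℝ :=
  Real.sqrt (∑ a, ∑ b, M a b ^ 2)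

/-- The `k`-th unfolding of a tensor `A`: the matrix of size
`(n₁⋯n_k) × (n_{k+1}⋯n_d)` (rows indexed by the first `k` modes, columns by the
remaining modes) with `A_k((i₁,…,i_k), (i_{k+1},…,i_d)) = A(i₁,…,i_d)`. -/
def unfolding {d : ℕ} (n : Fin d → ℕ) (A : Tensor n) (k : ℕ) :
    Matrix ((l : {l : Fin d // (l : ℕ) < k}) → Fin (n l.1))
      ((l : {l : Fin d // ¬ (l : ℕ) < k}) → Fin (n l.1)) ℝ :=
  fun p q => A fun l => if h : (l : ℕ) < k then p ⟨l, h⟩ else q ⟨l, h⟩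

/-- `ε_k`: the Frobenius-norm distance from the `k`-th unfolding `A_k` to its best
approximation of rank at most `r k`. -/
noncomputable def bestRankErr {d : ℕ} (n : Fin d → ℕ) (A : Tensor n) (r : ℕ → ℕ)
    (k : ℕ) : ℝ :=
  sInf {c : ℝ |
    ∃ M : Matrix ((l : {l : Fin d // (l : ℕ) < k}) → Fin (n l.1))
        ((l : {l : Fin d // ¬ (l : ℕ) < k}) → Fin (n l.1)) ℝ,
      M.rank ≤ r k ∧ c = frobM (unfolding n A k - M)}

namespace TTaux

open Matrix

/-- Row multi-indices of the first `k` modes. -/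
abbrev Row {d : ℕ} (n : Fin d → ℕ) (k : ℕ) : Type :=
  (l : {l : Fin d // (l : ℕ) < k}) → Fin (n l.1)

/-- Column multi-indices. -/
abbrev Col {d : ℕ} (n : Fin d → ℕ) (k : ℕ) : Type :=
  (l : {l : Fin d // ¬ (l : ℕ) < k}) → Fin (n l.1)

def comb {d : ℕ} {n : Fin d → ℕ} {k : ℕ} (p : Row n k) (q : Col n k) :
    (l : Fin d) → Fin (n l) :=
  fun l => if h : (l : ℕ) < k then p ⟨l, h⟩ else q ⟨l, h⟩

def glue {d : ℕ} {n : Fin d → ℕ} {k : ℕ} (p : Row n k) (i : (l : Fin d) → Fin (n l)) :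
    (l : Fin d) → Fin (n l) :=
  fun l => if h : (l : ℕ) < k then p ⟨l, h⟩ else i l

def restr {d : ℕ} {n : Fin d → ℕ} (k : ℕ) (i : (l : Fin d) → Fin (n l)) : Row n k :=
  fun l => i l.1

def snoc {d : ℕ} {n : Fin d → ℕ} (k : Fin d) (p : Row n (k : ℕ)) (x : Fin (n k)) :
    Row n ((k : ℕ) + 1) :=
  fun l => if h : (l.1 : ℕ) < k then p ⟨l.1, h⟩ else
    Fin.cast (congrArg n (Fin.ext (by have := l.2; omega))) x

theorem snoc_eq {d : ℕ} {n : Fin d → ℕ} (k : Fin d) (p : Row n (k : ℕ))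
    (i : (l : Fin d) → Fin (n l)) : snoc k p (i k) = restr ((k : ℕ) + 1) (glue p i) := by
  funext l
  obtain ⟨l, hl⟩ := l
  simp only [snoc, restr, glue]
  split_ifs with h
  · rfl
  · have : k = l := Fin.ext (by omega)
    subst this
    rfl

theorem glue_glue {d : ℕ} {n : Fin d → ℕ} (k : ℕ) (K : Row n (k + 1)) (J : Row n k)
    (i : (l : Fin d) → Fin (n l)) : glue K (glue J i) = glue K i := by
  funext l
  simp only [glue]
  split_ifs with h1 h2
  · rfl
  · omega
  · rfl

theorem glue_comb {d : ℕ} {n : Fin d → ℕ} {k : ℕ} (p p' : Row n k) (q : Col n k) :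
    glue p (comb p' q) = comb p q := by
  funext l
  simp only [glue, comb]
  split_ifs <;> rfl

theorem restr_comb {d : ℕ} {n : Fin d → ℕ} {k : ℕ} (p : Row n k) (q : Col n k) :
    restr k (comb p q) = p := by
  funext l
  simp [restr, comb, l.2]

theorem sum_comb {d : ℕ} {n : Fin d → ℕ} (k : ℕ) (F : ((l : Fin d) → Fin (n l)) → ℝ) :
    ∑ i, F i = ∑ q : Col n k, ∑ p : Row n k, F (comb p q) := by
  rw [Finset.sum_comm, ← Fintype.sum_prod_type']
  exact Fintype.sum_equiv (Equiv.piEquivPiSubtypeProd (fun l : Fin d => (l : ℕ) < k)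
    (fun l => Fin (n l))) _ _ (fun i => by
      congr 1
      funext l
      simp only [comb, Equiv.piEquivPiSubtypeProd]
      split_ifs <;> rfl)

section vec
variable {ι : Type*} [Fintype ι]

theorem orth {P : Matrix ι ι ℝ} (hs : Pᵀ = P) (hi : P * P = P) (x z : ι → ℝ) :
    (x - P *ᵥ x) ⬝ᵥ (P *ᵥ z) = 0 := by
  rw [Matrix.dotProduct_mulVec, ← Matrix.mulVec_transpose, hs, Matrix.mulVec_sub,
    Matrix.mulVec_mulVec, hi, sub_self, zero_dotProduct]

theorem pyth {P : Matrix ι ι ℝ} (hs : Pᵀ = P) (hi : P * P = P) (x y : ι → ℝ) :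
    (x - P *ᵥ y) ⬝ᵥ (x - P *ᵥ y) =
      (x - P *ᵥ x) ⬝ᵥ (x - P *ᵥ x) + (P *ᵥ (x - y)) ⬝ᵥ (P *ᵥ (x - y)) := by
  have h : x - P *ᵥ y = (x - P *ᵥ x) + P *ᵥ (x - y) := by
    rw [Matrix.mulVec_sub]; abel
  have o := orth hs hi x (x - y)
  have o' := o
  rw [dotProduct_comm] at o'
  rw [h, add_dotProduct, dotProduct_add, dotProduct_add, o, o']
  ring

theorem dp_nonneg (x : ι → ℝ) : 0 ≤ x ⬝ᵥ x :=
  Finset.sum_nonneg fun i _ => mul_self_nonneg (x i)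

theorem contr {P : Matrix ι ι ℝ} (hs : Pᵀ = P) (hi : P * P = P) (z : ι → ℝ) :
    (P *ᵥ z) ⬝ᵥ (P *ᵥ z) ≤ z ⬝ᵥ z := by
  have := pyth hs hi z 0
  simp only [Matrix.mulVec_zero, sub_zero] at this
  have h := dp_nonneg (z - P *ᵥ z)
  linarith

theorem step_vec {P : Matrix ι ι ℝ} (hs : Pᵀ = P) (hi : P * P = P) (x y : ι → ℝ) :
    (x - P *ᵥ y) ⬝ᵥ (x - P *ᵥ y) ≤
      (x - P *ᵥ x) ⬝ᵥ (x - P *ᵥ x) + (x - y) ⬝ᵥ (x - y) := by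
  rw [pyth hs hi]
  have := contr hs hi (x - y)
  linarith

theorem opt_vec {P : Matrix ι ι ℝ} (hs : Pᵀ = P) (hi : P * P = P) (x y : ι → ℝ)
    (hy : P *ᵥ y = y) :
    (x - P *ᵥ x) ⬝ᵥ (x - P *ᵥ x) ≤ (x - y) ⬝ᵥ (x - y) := by
  have h := pyth hs hi x y
  rw [hy] at h
  have := dp_nonneg (P *ᵥ (x - y))
  linarith

end vec

theorem exists_frame {α β : Type*} [Fintype α] [Fintype β] (M : Matrix α β ℝ) (r : ℕ)
    (hr : M.rank ≤ r) : ∃ U : Matrix α (Fin r) ℝ,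
      (U * Uᵀ) * (U * Uᵀ) = U * Uᵀ ∧ (U * Uᵀ) * M = M := by
  classical
  let e := (WithLp.linearEquiv 2 ℝ (α → ℝ)).symm
  let V : Submodule ℝ (EuclideanSpace ℝ α) :=
    (Submodule.span ℝ (Set.range M.col)).map e.toLinearMap
  have hV : Module.finrank ℝ V ≤ r := by
    rw [LinearEquiv.finrank_map_eq, ← Matrix.rank_eq_finrank_span_cols]
    exact hr
  let b := stdOrthonormalBasis ℝ V
  let U : Matrix α (Fin r) ℝ := fun i a =>
    if h : (a : ℕ) < Module.finrank ℝ V then (b ⟨a, h⟩ : EuclideanSpace ℝ α) i else 0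
  have key : ∀ v : V, (U * Uᵀ) *ᵥ (WithLp.ofLp (v : EuclideanSpace ℝ α)) =
      WithLp.ofLp (v : EuclideanSpace ℝ α) := by
    intro v
    funext i
    rw [← Matrix.mulVec_mulVec]
    have h1 := b.sum_repr' v
    have h2 := congrArg (fun w : V => (w : EuclideanSpace ℝ α) i) h1
    simp only [Submodule.coe_sum, Submodule.coe_smul, WithLp.ofLp_sum, Finset.sum_apply,
      PiLp.smul_apply, smul_eq_mul] at h2
    rw [← h2]
    simp only [Matrix.mulVec, dotProduct]
    symm
    refine Finset.sum_of_injOn (Fin.castLE hV) (Fin.castLE_injective hV).injOn (by simp) ?_ ?_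
    · intro a _ ha
      have : ¬ (a : ℕ) < Module.finrank ℝ V := by
        intro h
        exact ha ⟨⟨a, h⟩, by simp, by ext; simp⟩
      simp [U, this]
    · intro a _
      simp only [Matrix.transpose_apply]
      simp [U, Submodule.coe_inner, PiLp.inner_apply, mul_comm]
  have hU : (U * Uᵀ) * U = U := by
    ext i a
    by_cases h : (a : ℕ) < Module.finrank ℝ V
    · have := congrFun (key (b ⟨a, h⟩)) i
      have e1 : (fun j => U j a) = WithLp.ofLp (b ⟨a, h⟩ : EuclideanSpace ℝ α) := by
        funext j; simp [U, h]
      rw [← e1] at this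
      exact this
    · have e1 : ∀ j, U j a = 0 := by intro j; simp [U, h]
      rw [Matrix.mul_apply]
      simp [e1]
  refine ⟨U, ?_, ?_⟩
  · rw [← Matrix.mul_assoc, hU]
  · ext i c
    have hc : e (M.col c) ∈ V := Submodule.mem_map_of_mem (Submodule.subset_span ⟨c, rfl⟩)
    exact congrFun (key ⟨_, hc⟩) i

/-- squared error of the projection -/
def perr {α β : Type*} [Fintype α] [Fintype β] {r : ℕ} (A : Matrix α β ℝ)
    (U : Matrix α (Fin r) ℝ) : ℝ :=
  ∑ a, ∑ b, (A - (U * Uᵀ) * A) a b ^ 2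

theorem perr_le {α β : Type*} [Fintype α] [Fintype β] {r : ℕ} (A M : Matrix α β ℝ)
    (U : Matrix α (Fin r) ℝ) (hi : (U * Uᵀ) * (U * Uᵀ) = U * Uᵀ) (hM : (U * Uᵀ) * M = M) :
    perr A U ≤ ∑ a, ∑ b, (A - M) a b ^ 2 := by
  unfold perr
  rw [Finset.sum_comm, Finset.sum_comm (f := fun a b => (A - M) a b ^ 2)]
  refine Finset.sum_le_sum fun c _ => ?_
  have hy : (U * Uᵀ) *ᵥ (fun j => M j c) = fun j => M j c := by
    funext i; exact congrFun (congrFun hM i) c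
  have := opt_vec (by simp) hi (fun j => A j c) (fun j => M j c) hy
  simp only [dotProduct, ← sq] at this
  exact this

theorem exists_best {α β : Type*} [Fintype α] [Fintype β] (A : Matrix α β ℝ) (r : ℕ) :
    ∃ U : Matrix α (Fin r) ℝ, (U * Uᵀ) * (U * Uᵀ) = U * Uᵀ ∧
      ∀ M : Matrix α β ℝ, M.rank ≤ r → perr A U ≤ frobM (A - M) ^ 2 := by
  classical
  let C : Set (Matrix α (Fin r) ℝ) := {U | (U * Uᵀ) * (U * Uᵀ) = U * Uᵀ}
  have hclosed : IsClosed C := by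
    apply isClosed_eq <;> fun_prop
  have hsub : C ⊆ Set.pi Set.univ (fun _ : α => Set.pi Set.univ
      (fun _ : Fin r => Set.Icc (-1 : ℝ) 1)) := by
    intro U hU i _ a _
    have h1 : (U * Uᵀ) i i = ∑ j, (U * Uᵀ) i j ^ 2 := by
      have h := congrFun (congrFun (show (U * Uᵀ) * (U * Uᵀ) = U * Uᵀ from hU) i) i
      rw [← h, Matrix.mul_apply]
      refine Finset.sum_congr rfl fun j _ => ?_
      have : (U * Uᵀ) j i = (U * Uᵀ) i j := by
        have : (U * Uᵀ)ᵀ = U * Uᵀ := by simp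
        exact congrFun (congrFun this i) j
      rw [this, sq]
    have h2 : (U * Uᵀ) i i ^ 2 ≤ (U * Uᵀ) i i := by
      conv_rhs => rw [h1]
      exact Finset.single_le_sum (f := fun j => (U * Uᵀ) i j ^ 2)
        (fun j _ => sq_nonneg _) (Finset.mem_univ i)
    have h3 : U i a ^ 2 ≤ (U * Uᵀ) i i := by
      rw [Matrix.mul_apply]
      simp only [Matrix.transpose_apply, ← sq]
      exact Finset.single_le_sum (f := fun j => U i j ^ 2)
        (fun j _ => sq_nonneg _) (Finset.mem_univ a)
    have h4 : U i a ^ 2 ≤ 1 := by nlinarith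
    exact abs_le.mp ((sq_le_one_iff_abs_le_one _).mp h4)
  have hcomp : IsCompact C :=
    (isCompact_univ_pi fun _ => isCompact_univ_pi fun _ => isCompact_Icc).of_isClosed_subset
      hclosed hsub
  have hcont : Continuous (fun U : Matrix α (Fin r) ℝ => perr A U) := by
    unfold perr
    refine continuous_finsetSum _ fun a _ => continuous_finsetSum _ fun b _ => ?_
    refine Continuous.pow ?_ 2
    refine Continuous.matrix_elem ?_ a b
    fun_prop
  obtain ⟨U, hU, hmin⟩ := hcomp.exists_isMinOn ⟨0, by simp [C]⟩ hcont.continuousOn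
  refine ⟨U, hU, fun M hM => ?_⟩
  obtain ⟨U', hU', hM'⟩ := exists_frame M r hM
  refine (hmin hU').trans ((perr_le A M U' hU' hM').trans ?_)
  unfold frobM
  exact (Real.sq_sqrt
    (Finset.sum_nonneg fun _ _ => Finset.sum_nonneg fun _ _ => sq_nonneg _)).ge

theorem exists_U {d : ℕ} (n : Fin d → ℕ) (A : Tensor n) (r : ℕ → ℕ) (k : ℕ) :
    ∃ U : Matrix (Row n k) (Fin (r k)) ℝ, (U * Uᵀ) * (U * Uᵀ) = U * Uᵀ ∧
      perr (unfolding n A k) U ≤ bestRankErr n A r k ^ 2 := by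
  obtain ⟨U, hU, h⟩ := exists_best (unfolding n A k) (r k)
  refine ⟨U, hU, ?_⟩
  have h0 : 0 ≤ perr (unfolding n A k) U :=
    Finset.sum_nonneg fun _ _ => Finset.sum_nonneg fun _ _ => sq_nonneg _
  have : Real.sqrt (perr (unfolding n A k) U) ≤ bestRankErr n A r k := by
    refine le_csInf ⟨_, 0, by simp, rfl⟩ ?_
    rintro c ⟨M, hM, rfl⟩
    exact Real.sqrt_le_iff.mpr ⟨Real.sqrt_nonneg _, h M hM⟩
  exact (Real.sqrt_le_left (this.trans' (Real.sqrt_nonneg _))).mp this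

/-- Projection of a tensor along the first `k` modes. -/
def proj {d : ℕ} {n : Fin d → ℕ} {k s : ℕ} (U : Matrix (Row n k) (Fin s) ℝ)
    (X : ((l : Fin d) → Fin (n l)) → ℝ) (i : (l : Fin d) → Fin (n l)) : ℝ :=
  ∑ J, (U * Uᵀ) (restr k i) J * X (glue J i)

theorem proj_comb {d : ℕ} {n : Fin d → ℕ} {k s : ℕ} (U : Matrix (Row n k) (Fin s) ℝ)
    (X : ((l : Fin d) → Fin (n l)) → ℝ) (p : Row n k) (q : Col n k) :
    proj U X (comb p q) = ((U * Uᵀ) *ᵥ (fun J => X (comb J q))) p := by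
  simp only [proj, restr_comb, glue_comb, Matrix.mulVec, dotProduct]

theorem proj_step {d : ℕ} {n : Fin d → ℕ} {k s : ℕ} (U : Matrix (Row n k) (Fin s) ℝ)
    (hi : (U * Uᵀ) * (U * Uᵀ) = U * Uᵀ)
    (X Y : ((l : Fin d) → Fin (n l)) → ℝ) :
    ∑ i, (X i - proj U Y i) ^ 2 ≤
      perr (unfolding n X k) U + ∑ i, (X i - Y i) ^ 2 := by
  have e : perr (unfolding n X k) U = ∑ i, (X i - proj U X i) ^ 2 := by
    rw [sum_comb k, Finset.sum_comm]
    simp only [proj_comb]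
    rfl
  rw [e, sum_comb k, sum_comb k (fun i => (X i - proj U X i) ^ 2),
    sum_comb k (fun i => (X i - Y i) ^ 2), ← Finset.sum_add_distrib]
  refine Finset.sum_le_sum fun q _ => ?_
  simp only [proj_comb]
  have := step_vec (by simp) hi (fun J => X (comb J q)) (fun J => Y (comb J q))
  simp only [dotProduct, ← sq] at this
  exact this

section main
variable {d : ℕ} {n : Fin d → ℕ} (s : ℕ → ℕ) (U : (k : ℕ) → Matrix (Row n k) (Fin (s k)) ℝ)

def cores : TTCores (fun k : Fin (d + 1) => s k) n := fun k x =>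
  Matrix.of fun a b => ∑ J : Row n (k : ℕ), U k J a * U (k + 1) (snoc k J x) b

/-- Partial operator. -/
def Q (e : Fin (s 0)) (j : ℕ) (hj : j ≤ d) (X : ((l : Fin d) → Fin (n l)) → ℝ)
    (i : (l : Fin d) → Fin (n l)) : ℝ :=
  ∑ J : Row n j, ∑ a, ttPartial (fun k : Fin (d + 1) => s k) n (cores s U) i j hj e a *
    U j J a * X (glue J i)

theorem partial_succ (e : Fin (s 0)) (j : ℕ) (hj : j + 1 ≤ d)
    (i : (l : Fin d) → Fin (n l)) (b : Fin (s (j + 1))) :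
    ttPartial (fun k : Fin (d + 1) => s k) n (cores s U) i (j + 1) hj e b =
      Q s U e j (Nat.le_of_succ_le hj) (fun i => U (j + 1) (restr (j + 1) i) b) i := by
  rw [ttPartial]
  erw [Matrix.mul_apply]
  unfold Q
  rw [Finset.sum_comm]
  refine Finset.sum_congr rfl fun a _ => ?_
  simp only [cores, Matrix.of_apply, Finset.mul_sum]
  refine Finset.sum_congr rfl fun J _ => ?_
  rw [← mul_assoc]
  congr 2
  exact snoc_eq ⟨j, hj⟩ J i

theorem Q_succ (e : Fin (s 0)) (j : ℕ) (hj : j + 1 ≤ d)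
    (X : ((l : Fin d) → Fin (n l)) → ℝ) (i : (l : Fin d) → Fin (n l)) :
    Q s U e (j + 1) hj X i = Q s U e j (Nat.le_of_succ_le hj) (proj (U (j + 1)) X) i := by
  rw [Q]
  simp only [partial_succ]
  simp only [Q, proj, glue_glue, Matrix.mul_apply, Matrix.transpose_apply, Finset.sum_mul,
    Finset.mul_sum]
  rw [Finset.sum_congr rfl fun K _ => Finset.sum_comm]
  rw [Finset.sum_comm]
  refine Finset.sum_congr rfl fun J _ => ?_
  rw [Finset.sum_congr rfl fun K _ => Finset.sum_comm]
  rw [Finset.sum_comm]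
  refine Finset.sum_congr rfl fun a _ => ?_
  refine Finset.sum_congr rfl fun K _ => ?_
  refine Finset.sum_congr rfl fun b _ => ?_
  ring

theorem Q_zero (e : Fin (s 0)) (h : ∀ J, U 0 J e = 1)
    (X : ((l : Fin d) → Fin (n l)) → ℝ) (i : (l : Fin d) → Fin (n l)) :
    Q s U e 0 (Nat.zero_le d) X i = X i := by
  have hu : ∀ J : Row n 0, J = restr 0 i := fun J => funext fun l => absurd l.2 (by omega)
  have hg : ∀ J : Row n 0, glue J i = i := fun J => funext fun l => by simp [glue]
  unfold Q
  rw [Finset.sum_eq_single (restr 0 i) (fun J _ hJ => absurd (hu J) hJ) (by simp)]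
  rw [Finset.sum_eq_single e]
  · rw [h, hg, ttPartial]
    erw [Matrix.one_apply_eq]
    ring
  · intro a _ ha
    rw [ttPartial]
    erw [Matrix.one_apply_ne (Ne.symm ha)]
    ring
  · simp

theorem Q_err (e : Fin (s 0)) (h : ∀ J, U 0 J e = 1) (A : Tensor n) (r : ℕ → ℕ)
    (hU : ∀ k, 1 ≤ k → k < d → (U k * (U k)ᵀ) * (U k * (U k)ᵀ) = U k * (U k)ᵀ ∧
      perr (unfolding n A k) (U k) ≤ bestRankErr n A r k ^ 2)
    (j : ℕ) : ∀ (hj : j < d) (Y : ((l : Fin d) → Fin (n l)) → ℝ),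
    ∑ i, (A i - Q s U e j hj.le Y i) ^ 2 ≤
      ∑ k ∈ Finset.Ico 1 (j + 1), bestRankErr n A r k ^ 2 + ∑ i, (A i - Y i) ^ 2 := by
  induction j with
  | zero =>
    intro hj Y
    simp only [Q_zero s U e h]
    simp
  | succ j ih =>
    intro hj Y
    simp only [Q_succ]
    have h1 := ih (by omega) (proj (U (j + 1)) Y)
    obtain ⟨h2, h3⟩ := hU (j + 1) (by omega) hj
    have h4 := proj_step (U (j + 1)) h2 A Y
    rw [Finset.sum_Ico_succ_top (by omega)]
    linarith

end main

theorem choose_U {d : ℕ} (hd : 1 ≤ d) {n : Fin d → ℕ} (A : Tensor n) (r : ℕ → ℕ) (k : ℕ) :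
    ∃ (s : ℕ) (U : Matrix (Row n k) (Fin s) ℝ),
      (k = 0 → s = 1 ∧ ∀ J a, U J a = 1) ∧
      (k = d → s = 1 ∧ ∀ i a, U (restr k i) a = A i) ∧
      (1 ≤ k → k < d → s = r k ∧ (U * Uᵀ) * (U * Uᵀ) = U * Uᵀ ∧
        perr (unfolding n A k) U ≤ bestRankErr n A r k ^ 2) := by
  by_cases h0 : k = 0
  · exact ⟨1, fun _ _ => 1, fun _ => ⟨rfl, fun _ _ => rfl⟩, fun h => by omega, fun h => by omega⟩
  by_cases h1 : k = d
  · refine ⟨1, fun J _ => A fun l => J ⟨l, by rw [h1]; exact l.2⟩, fun h => by omega,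
      fun _ => ⟨rfl, fun _ _ => rfl⟩, fun h => by omega⟩
  · obtain ⟨U, hU⟩ := exists_U n A r k
    exact ⟨r k, U, fun h => by omega, fun h => by omega, fun _ _ => ⟨rfl, hU⟩⟩

end TTaux

/-- TT-SVD approximation, Oseledets: given target ranks `r 1, …, r (d-1)`,
there is a tensor `B` in tensor-train format whose TT-ranks are at most
`r 1, …, r (d-1)` such that `‖A − B‖_F² ≤ ∑_{k=1}^{d-1} ε_k²`, where `ε_k` is the
Frobenius distance from the `k`-th unfolding `A_k` to its best rank-`r k`
approximation. -/
theorem tt_svd_approximation {d : ℕ} (hd : 1 ≤ d) {n : Fin d → ℕ} (A : Tensor n)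
    (r : ℕ → ℕ) :
    ∃ (r' : Fin (d + 1) → ℕ) (h0 : r' ⟨0, Nat.succ_pos d⟩ = 1)
      (hlast : r' ⟨d, Nat.lt_succ_self d⟩ = 1) (G : TTCores r' n),
      (∀ k : Fin (d + 1), 1 ≤ (k : ℕ) → (k : ℕ) ≤ d - 1 → r' k ≤ r k) ∧
      frobT (fun i => A i - ttEval r' n G h0 hlast i) ^ 2 ≤
        ∑ k ∈ Finset.Ico 1 d, bestRankErr n A r k ^ 2 := by
  choose s U hs0 hsd hsk using TTaux.choose_U hd A r
  obtain ⟨d, rfl⟩ : ∃ m, d = m + 1 := ⟨d - 1, by omega⟩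
  refine ⟨fun k => s k, (hs0 0 rfl).1, (hsd (d + 1) rfl).1, TTaux.cores s U, ?_, ?_⟩
  · intro k h1 h2
    exact (hsk k h1 (by omega)).1.le
  · unfold frobT
    rw [Real.sq_sqrt (Finset.sum_nonneg fun _ _ => sq_nonneg _)]
    let e : Fin (s 0) := Fin.cast (hs0 0 rfl).1.symm 0
    have h := TTaux.Q_err s U e (fun J => (hs0 0 rfl).2 J e) A r
      (fun k h1 h2 => (hsk k h1 h2).2) d (by omega) A
    simp only [sub_self] at h
    have hQ : ∀ i, ttEval (fun k : Fin (d + 1 + 1) => s k) n (TTaux.cores s U) (hs0 0 rfl).1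
        (hsd (d + 1) rfl).1 i = TTaux.Q s U e d (by omega) A i := by
      intro i
      unfold ttEval
      refine (TTaux.partial_succ s U e d le_rfl i _).trans ?_
      congr 1
      funext i
      exact (hsd (d + 1) rfl).2 i _
    simp only [hQ]
    simpa using h
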